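/- Let 0 < δ ≤ 1. There is a constant C(δ) such that for every k ∈ ℤ² with k ≠ 0, Σ_{h ∈ ℤ², h ≠ 0, h ≠ k} ‖h‖²·(‖k−h‖^{−δ} − ‖h‖^{−δ})² / ‖k−h‖² ≤ C(δ)·(‖k‖² + ‖k‖^{2−2δ}). -/

import Mathlib

/-- The Euclidean norm of a lattice point `k ∈ ℤ²`. -/
noncomputable def znorm (k : ℤ × ℤ) : ℝ := Real.sqrt ((k.1 : ℝ) ^ 2 + (k.2 : ℝ) ^ 2)

/-- `znorm` is the complex absolute value of the corresponding Gaussian integer. -/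
theorem znorm_eq_norm (k : ℤ × ℤ) : znorm k = ‖(⟨k.1, k.2⟩ : ℂ)‖ := by
  rw [Complex.norm_eq_sqrt_sq_add_sq, znorm]

theorem znorm_nonneg (k : ℤ × ℤ) : 0 ≤ znorm k := Real.sqrt_nonneg _

theorem norm_le_znorm (k : ℤ × ℤ) : ‖k‖ ≤ znorm k := by
  rw [Prod.norm_def, Int.norm_eq_abs, Int.norm_eq_abs]
  refine max_le (Real.abs_le_sqrt ?_) (Real.abs_le_sqrt ?_) <;>
    nlinarith [sq_nonneg (k.1 : ℝ), sq_nonneg (k.2 : ℝ)]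

theorem znorm_pos {k : ℤ × ℤ} (hk : k ≠ 0) : 0 < znorm k :=
  (norm_pos_iff.mpr hk).trans_le (norm_le_znorm k)

theorem abs_znorm_sub_znorm_le (k h : ℤ × ℤ) : |znorm h - znorm (k - h)| ≤ znorm k := by
  simp only [znorm_eq_norm]
  convert abs_norm_sub_norm_le (⟨h.1, h.2⟩ : ℂ) (-⟨(k - h).1, (k - h).2⟩) using 1
  · rw [norm_neg]
  · congr 1
    apply Complex.ext <;> simp

theorem summable_znorm_rpow {s : ℝ} (hs : 2 < s) :
    Summable fun k : ℤ × ℤ => znorm k ^ (-s) := by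
  have hsum : Summable fun k : ℤ × ℤ => ‖k‖ ^ (-s) := by
    rw [← (finTwoArrowEquiv ℤ).summable_iff]
    refine (EisensteinSeries.summable_one_div_norm_rpow hs).congr fun x => ?_
    simp [Prod.norm_def, EisensteinSeries.norm_eq_max_natAbs, Int.norm_eq_abs, Nat.cast_max]
  refine hsum.of_nonneg_of_le (fun k => Real.rpow_nonneg (znorm_nonneg k) _) fun k => ?_
  rcases eq_or_ne k 0 with rfl | hk
  · simp [znorm]
  · exact Real.rpow_le_rpow_of_nonpos (norm_pos_iff.mpr hk) (norm_le_znorm k) (by linarith)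

theorem abs_one_sub_rpow_le {t δ : ℝ} (ht : 0 < t) (hδ : 0 ≤ δ) (hδ1 : δ ≤ 1) :
    |1 - t ^ δ| ≤ |1 - t| := by
  rcases le_total t 1 with h | h
  · have h₁ := Real.rpow_le_rpow_of_exponent_ge ht h hδ1
    have h₂ := Real.rpow_le_one ht.le h hδ
    rw [Real.rpow_one] at h₁
    rw [abs_of_nonneg (by linarith), abs_of_nonneg (by linarith)]
    linarith
  · have h₁ := Real.rpow_le_rpow_of_exponent_le h hδ1
    have h₂ := Real.one_le_rpow h hδ
    rw [Real.rpow_one] at h₁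
    rw [abs_of_nonpos (by linarith), abs_of_nonpos (by linarith)]
    linarith

theorem mul_abs_rpow_neg_sub_rpow_neg_le {a b δ : ℝ} (ha : 0 < a) (hb : 0 < b) (hδ : 0 ≤ δ)
    (hδ1 : δ ≤ 1) : b * |a ^ (-δ) - b ^ (-δ)| ≤ |b - a| * a ^ (-δ) := by
  have hfac : a ^ (-δ) - b ^ (-δ) = (1 - (a / b) ^ δ) * a ^ (-δ) := by
    have := (Real.rpow_pos_of_pos ha δ).ne'
    have := (Real.rpow_pos_of_pos hb δ).ne'
    rw [Real.div_rpow ha.le hb.le, Real.rpow_neg ha.le, Real.rpow_neg hb.le]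
    field_simp
  have hba : b - a = b * (1 - a / b) := by field_simp
  rw [hfac, hba, abs_mul, abs_mul b, abs_of_pos hb,
    abs_of_pos (Real.rpow_pos_of_pos ha _),
    ← mul_assoc]
  refine mul_le_mul_of_nonneg_right ?_ (Real.rpow_nonneg ha.le _)
  exact mul_le_mul_of_nonneg_left (abs_one_sub_rpow_le (div_pos ha hb) hδ hδ1) hb.le

theorem znorm_sq_mul_sq_div_le {δ : ℝ} (hδ : 0 ≤ δ) (hδ1 : δ ≤ 1) {k h : ℤ × ℤ} (h0 : h ≠ 0)
    (hk : h ≠ k) :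
    znorm h ^ 2 * (znorm (k - h) ^ (-δ) - znorm h ^ (-δ)) ^ 2 / znorm (k - h) ^ 2
      ≤ znorm k ^ 2 * znorm (k - h) ^ (-(2 + 2 * δ)) := by
  have ha : 0 < znorm (k - h) := znorm_pos (sub_ne_zero.mpr hk.symm)
  have hle : znorm h * |znorm (k - h) ^ (-δ) - znorm h ^ (-δ)|
      ≤ znorm k * znorm (k - h) ^ (-δ) :=
    (mul_abs_rpow_neg_sub_rpow_neg_le ha (znorm_pos h0) hδ hδ1).trans
      (mul_le_mul_of_nonneg_right (abs_znorm_sub_znorm_le k h) (Real.rpow_nonneg ha.le _))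
  have hpow : znorm (k - h) ^ (-(2 + 2 * δ))
      = (znorm (k - h) ^ (-δ)) ^ 2 / znorm (k - h) ^ 2 := by
    rw [← Real.rpow_natCast (znorm (k - h) ^ (-δ)), ← Real.rpow_mul ha.le,
      ← Real.rpow_natCast (znorm (k - h)), ← Real.rpow_sub ha]
    congr 1
    push_cast
    ring
  rw [hpow, ← mul_div_assoc, ← sq_abs (_ - _), ← mul_pow, ← mul_pow]
  have := mul_nonneg (znorm_nonneg h) (abs_nonneg (znorm (k - h) ^ (-δ) - znorm h ^ (-δ)))
  gcongr

/-- The estimate of the sum `S₃` in the proof of Proposition 4.1: for `0 < δ ≤ 1` there is a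
constant `C(δ)` such that for every `k ≠ 0`,
`Σ_{h≠0, h≠k} ‖h‖²·(‖k−h‖^{−δ} − ‖h‖^{−δ})² / ‖k−h‖² ≤ C(δ)·(‖k‖² + ‖k‖^{2−2δ})`
(the sum being finite). -/
theorem S3_estimate (δ : ℝ) (hδ : 0 < δ) (hδ1 : δ ≤ 1) :
    ∃ C : ℝ, 0 < C ∧ ∀ k : ℤ × ℤ, k ≠ 0 →
      Summable (fun h : {h : ℤ × ℤ // h ≠ 0 ∧ h ≠ k} =>
        znorm (h : ℤ × ℤ) ^ 2
          * (znorm (k - (h : ℤ × ℤ)) ^ (-δ) - znorm (h : ℤ × ℤ) ^ (-δ)) ^ 2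
          / znorm (k - (h : ℤ × ℤ)) ^ 2) ∧
      (∑' h : {h : ℤ × ℤ // h ≠ 0 ∧ h ≠ k},
        znorm (h : ℤ × ℤ) ^ 2
          * (znorm (k - (h : ℤ × ℤ)) ^ (-δ) - znorm (h : ℤ × ℤ) ^ (-δ)) ^ 2
          / znorm (k - (h : ℤ × ℤ)) ^ 2)
        ≤ C * (znorm k ^ 2 + znorm k ^ (2 - 2 * δ)) := by
  have hsum := summable_znorm_rpow (s := 2 + 2 * δ) (by linarith)
  have hnn (k : ℤ × ℤ) : 0 ≤ znorm k ^ (-(2 + 2 * δ)) := Real.rpow_nonneg (znorm_nonneg k) _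
  have hC : 0 ≤ ∑' h : ℤ × ℤ, znorm h ^ (-(2 + 2 * δ)) := tsum_nonneg hnn
  refine ⟨(∑' h : ℤ × ℤ, znorm h ^ (-(2 + 2 * δ))) + 1, by linarith, fun k _ => ?_⟩
  have hinj : Function.Injective
      fun h : {h : ℤ × ℤ // h ≠ 0 ∧ h ≠ k} => k - (h : ℤ × ℤ) :=
    sub_right_injective.comp Subtype.val_injective
  have hbound := (hsum.comp_injective hinj).mul_left (znorm k ^ 2)
  have hterm (h : {h : ℤ × ℤ // h ≠ 0 ∧ h ≠ k}) :=
    znorm_sq_mul_sq_div_le hδ.le hδ1 h.2.1 h.2.2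
  have hS := hbound.of_nonneg_of_le (fun h => by positivity) hterm
  refine ⟨hS, (hS.tsum_le_tsum hterm hbound).trans ?_⟩
  rw [tsum_mul_left]
  have hcomp := tsum_comp_le_tsum_of_inj hsum hnn hinj
  have hK : 0 ≤ znorm k ^ (2 - 2 * δ) := Real.rpow_nonneg (znorm_nonneg k) _
  calc _ ≤ znorm k ^ 2 * ∑' h : ℤ × ℤ, znorm h ^ (-(2 + 2 * δ)) := by
        gcongr
        exact hcomp
    _ ≤ _ := by nlinarith [mul_nonneg hC hK, sq_nonneg (znorm k)]
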